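/- arXiv:1209.6258 — 3 statements merged into one kernel-verified Lean document; each statement's English description precedes it below -/
import Mathlib

section
/- Let k be a field and let Q be an affine monoid. Then Q is normal (i.e., Q = sat(Q)) if and only if k[sat(Q)], regarded as a module over k[Q] via the inclusion of monoids Q ⊆ sat(Q), has finite projective dimension over k[Q]. -/
open scoped Pointwise

/-- The lattice `ℤ^N`. -/
abbrev ZN (N : ℕ) : Type := Fin N → ℤ

/-- The subgroup of `ℤ^N` generated by a submonoid `Q`, i.e. `gp(Q)`. -/
def gp {N : ℕ} (Q : AddSubmonoid (ZN N)) : AddSubgroup (ZN N) :=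
  AddSubgroup.closure (Q : Set (ZN N))

/-- `F` is a face of the monoid `Q`. -/
def IsFace {N : ℕ} (Q F : AddSubmonoid (ZN N)) : Prop :=
  F ≤ Q ∧ ∀ a b : ZN N, a ∈ Q → b ∈ Q → (a + b ∈ F ↔ a ∈ F ∧ b ∈ F)

/-- The normalization (saturation) `sat(Q)` of `Q`:
all `q ∈ gp(Q)` such that `n • q ∈ Q` for some `n ≥ 1`. -/
def sat {N : ℕ} (Q : AddSubmonoid (ZN N)) : AddSubmonoid (ZN N) where
  carrier := {q | q ∈ gp Q ∧ ∃ n : ℕ, 1 ≤ n ∧ n • q ∈ Q}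
  zero_mem' := ⟨(gp Q).zero_mem, 1, le_refl 1, by simpa using Q.zero_mem⟩
  add_mem' := by
    rintro a b ⟨ha, n, hn, hna⟩ ⟨hb, m, hm, hmb⟩
    refine ⟨(gp Q).add_mem ha hb, n * m,
      Nat.one_le_iff_ne_zero.mpr (Nat.mul_ne_zero (by omega) (by omega)), ?_⟩
    have h1 : (n * m) • a ∈ Q := by
      rw [mul_comm, mul_smul]; exact AddSubmonoid.nsmul_mem Q hna m
    have h2 : (n * m) • b ∈ Q := by
      rw [mul_smul]; exact AddSubmonoid.nsmul_mem Q hmb n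
    rw [smul_add]; exact Q.add_mem h1 h2

/-- `Q` is contained in its normalization. -/
theorem le_sat {N : ℕ} (Q : AddSubmonoid (ZN N)) : Q ≤ sat Q := fun q hq =>
  ⟨AddSubgroup.subset_closure hq, 1, le_refl 1, by simpa using hq⟩

/-- The set of holes `sat(Q) ∖ Q`. -/
def holes {N : ℕ} (Q : AddSubmonoid (ZN N)) : Set (ZN N) :=
  (sat Q : Set (ZN N)) \ (Q : Set (ZN N))

/-- The localization `Q_F = {q - f : q ∈ Q, f ∈ F}`. -/
def loc {N : ℕ} (Q F : AddSubmonoid (ZN N)) : AddSubmonoid (ZN N) where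
  carrier := {x | ∃ q ∈ Q, ∃ f ∈ F, x = q - f}
  zero_mem' := ⟨0, Q.zero_mem, 0, F.zero_mem, by simp⟩
  add_mem' := by
    rintro a b ⟨q, hq, f, hf, rfl⟩ ⟨q', hq', f', hf', rfl⟩
    exact ⟨q + q', Q.add_mem hq hq', f + f', F.add_mem hf hf', by ring⟩

/-- `F` is a maximal face (w.r.t. inclusion) among the faces `G` of `Q` with
`G + m ⊆ D`. -/
def IsMaxFaceFor {N : ℕ} (Q : AddSubmonoid (ZN N)) (D : Set (ZN N))
    (F : AddSubmonoid (ZN N)) (m : ZN N) : Prop :=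
  IsFace Q F ∧ (∀ f ∈ F, f + m ∈ D) ∧
    ∀ G : AddSubmonoid (ZN N), IsFace Q G → (∀ g ∈ G, g + m ∈ D) → F ≤ G → G = F

/-- `gp(F) + q` is a family of holes of `Q` (with the face `F` and base point `q`). -/
def IsFamilyOfHolesWith {N : ℕ} (Q F : AddSubmonoid (ZN N)) (q : ZN N) : Prop :=
  q ∈ holes Q ∧ IsMaxFaceFor Q (holes Q) F q

/-- `S ⊆ gp(Q)` is a family of holes of `Q`. -/
def IsFamilyOfHoles {N : ℕ} (Q : AddSubmonoid (ZN N)) (S : Set (ZN N)) : Prop :=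
  ∃ (q : ZN N) (F : AddSubmonoid (ZN N)), IsFamilyOfHolesWith Q F q ∧
    S = (fun f => f + q) '' (gp F : Set (ZN N))

/-- `M ⊆ gp(Q)` is a `Q`-module. -/
def IsQModule {N : ℕ} (Q : AddSubmonoid (ZN N)) (M : Set (ZN N)) : Prop :=
  M ⊆ (gp Q : Set (ZN N)) ∧ ∀ q ∈ Q, ∀ m ∈ M, q + m ∈ M

/-- `M` is a finitely generated `Q`-module: a finite union of translates of `Q`. -/
def IsFGQModule {N : ℕ} (Q : AddSubmonoid (ZN N)) (M : Set (ZN N)) : Prop :=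
  IsQModule Q M ∧ ∃ s : Finset (ZN N), ↑s ⊆ M ∧
    M = ⋃ m ∈ s, {x | ∃ q ∈ Q, x = m + q}

/-- The rank of a subgroup of `ℤ^N`. -/
noncomputable def rk {N : ℕ} (A : AddSubgroup (ZN N)) : ℕ :=
  Module.finrank ℤ (AddSubgroup.toIntSubmodule A)

/-- The face `F₀` of units of `Q`. -/
def unitsFace {N : ℕ} (Q : AddSubmonoid (ZN N)) : AddSubmonoid (ZN N) where
  carrier := {q | q ∈ Q ∧ -q ∈ Q}
  zero_mem' := ⟨Q.zero_mem, by simpa using Q.zero_mem⟩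
  add_mem' := by
    rintro a b ⟨ha, ha'⟩ ⟨hb, hb'⟩
    exact ⟨Q.add_mem ha hb, by rw [neg_add]; exact Q.add_mem ha' hb'⟩

/-- The *dimension of a face `F` of `Q`: `rank gp(F) - rank gp(F₀)`. -/
noncomputable def sdim {N : ℕ} (Q F : AddSubmonoid (ZN N)) : ℕ :=
  rk (gp F) - rk (gp (unitsFace Q))

/-- The *dimension of `Q`: `rank gp(Q) - rank gp(F₀)`. -/
noncomputable def sdimQ {N : ℕ} (Q : AddSubmonoid (ZN N)) : ℕ :=
  rk (gp Q) - rk (gp (unitsFace Q))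

/-- `Q` is seminormal: `2q, 3q ∈ Q` implies `q ∈ Q` for `q ∈ gp(Q)`. -/
def Seminormal {N : ℕ} (Q : AddSubmonoid (ZN N)) : Prop :=
  ∀ q ∈ gp Q, (2 : ℕ) • q ∈ Q → (3 : ℕ) • q ∈ Q → q ∈ Q

/-- The canonical embedding `ℤ^N → ℚ^N`. -/
def toQ {N : ℕ} (x : ZN N) : Fin N → ℚ := fun i => (x i : ℚ)

/-- The `ℚ`-linear span of (the image in `ℚ^N` of) a submonoid `F` of `ℤ^N`. -/
def qspan {N : ℕ} (F : AddSubmonoid (ZN N)) : Submodule ℚ (Fin N → ℚ) :=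
  Submodule.span ℚ (toQ '' (F : Set (ZN N)))

/-- The inclusion of monoids `Q ⊆ sat Q` as an additive monoid homomorphism. -/
def satIncl {N : ℕ} (Q : AddSubmonoid (ZN N)) : ↥Q →+ ↥(sat Q) :=
  AddSubmonoid.inclusion (le_sat Q)

/-- The induced ring homomorphism `k[Q] →+* k[sat Q]`. -/
noncomputable def satMap (k : Type) [Field k] {N : ℕ} (Q : AddSubmonoid (ZN N)) :
    AddMonoidAlgebra k ↥Q →+* AddMonoidAlgebra k ↥(sat Q) :=
  AddMonoidAlgebra.mapDomainRingHom k (satIncl Q)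

/-- `k[sat Q]` as a `k[Q]`-algebra (hence a `k[Q]`-module) via the inclusion
of monoids `Q ⊆ sat Q`. -/
noncomputable instance satAlg (k : Type) [Field k] {N : ℕ} (Q : AddSubmonoid (ZN N)) :
    Algebra (AddMonoidAlgebra k ↥Q) (AddMonoidAlgebra k ↥(sat Q)) :=
  (satMap k Q).toAlgebra

/-- The monomial ideal `p_F ⊆ k[Q]`, spanned by the monomials `x^q` with `q ∈ Q ∖ F`.
(Since `F` is a face, the ideal generated by these monomials coincides with their
`k`-linear span.) -/
noncomputable def pIdeal (k : Type) [Field k] {N : ℕ} (Q F : AddSubmonoid (ZN N)) :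
    Ideal (AddMonoidAlgebra k ↥Q) :=
  Ideal.span {x | ∃ q : ↥Q, (q : ZN N) ∉ F ∧ x = AddMonoidAlgebra.single q (1 : k)}

/-- The quotient `C` of `k[sat Q]` by the image of `k[Q]`, as a `k[Q]`-module. -/
noncomputable abbrev holeModule (k : Type) [Field k] {N : ℕ} (Q : AddSubmonoid (ZN N)) :=
  AddMonoidAlgebra k ↥(sat Q) ⧸
    LinearMap.range (Algebra.linearMap (AddMonoidAlgebra k ↥Q) (AddMonoidAlgebra k ↥(sat Q)))

universe u

theorem QuotSMulTop.lTensor_injective_of_isSMulRegular_cokernel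
    {A K F M : Type*} [CommRing A] [AddCommGroup K] [Module A K]
    [AddCommGroup F] [Module A F] [AddCommGroup M] [Module A M]
    {f : K →ₗ[A] F} {g : F →ₗ[A] M} (hf : Function.Injective f) (hfg : Function.Exact f g)
    {x : A} (hx : IsSMulRegular M x) :
    Function.Injective (f.lTensor (A ⧸ Ideal.span {x})) := by
  have h0 : Function.Exact (0 : K →ₗ[A] K) f :=
    (f.exact_zero_iff_injective K).2 hf
  have h1 := QuotSMulTop.map_first_exact_on_four_term_exact_of_isSMulRegular_last h0 hfg hx
  rw [map_zero, LinearMap.exact_zero_iff_injective] at h1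
  have h2 : ⇑(f.lTensor (A ⧸ Ideal.span {x})) ∘ QuotSMulTop.equivQuotTensor x K =
      QuotSMulTop.equivQuotTensor x F ∘ QuotSMulTop.map x f := by
    exact congrArg DFunLike.coe (QuotSMulTop.equivQuotTensor_naturality x f).symm
  rw [← Function.Injective.of_comp_iff' _ (QuotSMulTop.equivQuotTensor x K).bijective, h2]
  exact (QuotSMulTop.equivQuotTensor x F).injective.comp h1

theorem Module.free_of_projective_syzygy
    {A K F M : Type*} [CommRing A] [IsLocalRing A] [AddCommGroup K] [Module A K]
    [AddCommGroup F] [Module A F] [AddCommGroup M] [Module A M]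
    [Module.Finite A K] [Module.Projective A K] [Module.Finite A F] [Module.Free A F]
    {f : K →ₗ[A] F} {g : F →ₗ[A] M} (hf : Function.Injective f) (hfg : Function.Exact f g)
    (hg : Function.Surjective g) {x y : A} (hx : IsSMulRegular M x)
    (hxy : ∀ a, a ∈ IsLocalRing.maximalIdeal A ↔ x ∣ a * y) : Module.Free A M := by
  refine Module.free_of_lTensor_residueField_injective f g hg hfg ?_
  let ψ : A →ₗ[A] A ⧸ Ideal.span {x} := LinearMap.toSpanSingleton A _ (Ideal.Quotient.mk _ y)
  have hψ : ∀ a, ψ a = 0 ↔ a ∈ IsLocalRing.maximalIdeal A := fun a ↦ by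
    rw [hxy, ← Ideal.mem_span_singleton, ← Ideal.Quotient.eq_zero_iff_mem]
    simp [ψ, Algebra.smul_def]
  let φ : IsLocalRing.ResidueField A →ₗ[A] A ⧸ Ideal.span {x} :=
    (IsLocalRing.maximalIdeal A).liftQ ψ fun a ha ↦ (hψ a).2 ha
  have hφ : Function.Injective φ := by
    rw [← LinearMap.ker_eq_bot]
    exact Submodule.ker_liftQ_eq_bot _ _ _ fun a ha ↦ (hψ a).1 ha
  have h1 : Function.Injective (φ.rTensor K) :=
    Module.Flat.rTensor_preserves_injective_linearMap φ hφ
  have h2 := (QuotSMulTop.lTensor_injective_of_isSMulRegular_cokernel hf hfg hx).comp h1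
  rw [← LinearMap.coe_comp, LinearMap.lTensor_comp_rTensor, ← LinearMap.rTensor_comp_lTensor,
    LinearMap.coe_comp] at h2
  exact h2.of_comp

open CategoryTheory in
theorem Module.projective_localizedModule_of_hasProjectiveDimensionLE
    {R : Type u} [CommRing R] [IsDomain R] [IsNoetherianRing R] (p : Ideal R) [p.IsPrime]
    {x y : R} (hx : x ≠ 0) (hxy : ∀ a, a ∈ p ↔ x ∣ a * y) (n : ℕ)
    (M : Type u) [AddCommGroup M] [Module R M] [Module.Finite R M] [Module.IsTorsionFree R M]
    (h : HasProjectiveDimensionLE (ModuleCat.of R M) n) :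
    Module.Projective (Localization p.primeCompl) (LocalizedModule p.primeCompl M) := by
  induction n generalizing M with
  | zero =>
    rw [← projective_iff_hasProjectiveDimensionLE_zero, ← IsProjective.iff_projective] at h
    exact Module.projective_of_isLocalizedModule p.primeCompl (LocalizedModule.mkLinearMap _ M)
  | succ n ih =>
    obtain ⟨m, f, hf⟩ := Module.Finite.exists_fin' R M
    have hK : HasProjectiveDimensionLE (ModuleCat.of R (LinearMap.ker f)) n :=
      ((LinearMap.shortExact_shortComplexKer hf).hasProjectiveDimensionLT_X₃_iff n
        (ModuleCat.projective_of_categoryTheory_projective _)).1 h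
    have := ih _ hK
    let A := Localization.AtPrime p
    have hfree : Module.Free A (LocalizedModule p.primeCompl (Fin m → R)) :=
      Module.free_of_isLocalizedModule p.primeCompl (LocalizedModule.mkLinearMap _ _)
    have hAxy : ∀ a : A, a ∈ IsLocalRing.maximalIdeal A ↔
        algebraMap R A x ∣ a * algebraMap R A y := by
      intro a
      constructor
      · intro ha
        obtain ⟨r, t, rfl⟩ := IsLocalization.exists_mk'_eq p.primeCompl a
        obtain ⟨c, hc⟩ := (hxy r).1 ((IsLocalization.AtPrime.mk'_mem_maximal_iff A p r t).1 ha)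
        refine ⟨IsLocalization.mk' A c t, ?_⟩
        rw [mul_comm _ (algebraMap R A y), IsLocalization.mul_mk'_eq_mk'_of_mul,
          IsLocalization.mul_mk'_eq_mk'_of_mul, mul_comm, hc]
      · intro hdvd
        by_contra ha
        have hunit : IsUnit a := by simpa using ha
        obtain ⟨c, hc⟩ := hunit.dvd_mul_left.1 hdvd
        obtain ⟨r, t, rfl⟩ := IsLocalization.exists_mk'_eq p.primeCompl c
        rw [IsLocalization.mul_mk'_eq_mk'_of_mul, eq_comm, IsLocalization.mk'_eq_iff_eq_mul,
          ← map_mul] at hc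
        have := IsLocalization.injective A p.primeCompl_le_nonZeroDivisors hc
        exact t.2 ((hxy t).2 ⟨r, by rw [this, mul_comm]⟩)
    have hreg : IsSMulRegular (LocalizedModule p.primeCompl M) (algebraMap R A x) :=
      IsSMulRegular.of_isLocalizedModule A p.primeCompl (LocalizedModule.mkLinearMap _ M)
        (IsSMulRegular.of_ne_zero hx)
    have h1 : Function.Injective (LocalizedModule.map p.primeCompl (LinearMap.ker f).subtype) :=
      LocalizedModule.map_injective _ _ (Submodule.subtype_injective _)
    have h2 : Function.Surjective (LocalizedModule.map p.primeCompl f) :=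
      LocalizedModule.map_surjective _ _ hf
    have h3 : Function.Exact (LocalizedModule.map p.primeCompl (LinearMap.ker f).subtype)
        (LocalizedModule.map p.primeCompl f) :=
      LocalizedModule.map_exact p.primeCompl _ _ f.exact_subtype_ker_map
    have : Module.Free A (LocalizedModule p.primeCompl M) :=
      Module.free_of_projective_syzygy (K := LocalizedModule p.primeCompl (LinearMap.ker f))
        h1 h3 h2 hreg hAxy
    exact Module.Projective.of_free

/-- A torsion-free algebra `T` over a domain `A` which is projective and generically equal to `A`
is equal to `A`. -/
theorem Algebra.algebraMap_surjective_of_projective_of_birational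
    {A T : Type*} [CommRing A] [IsDomain A] [CommRing T] [Algebra A T]
    [Module.IsTorsionFree A T] [Module.Projective A T]
    (h : ∀ t : T, ∃ a : A, a ≠ 0 ∧ a • t ∈ (algebraMap A T).range) :
    Function.Surjective (algebraMap A T) := by
  obtain ⟨g, hg⟩ := (Module.projective_def' (R := A) (P := T)).1 inferInstance
  have key : ∀ u i : T, u * algebraMap A T (g 1 i) = algebraMap A T (g u i) := by
    intro u i
    obtain ⟨a, ha, b, hb⟩ := h u
    have h1 : a • g u = b • g 1 := by
      rw [← map_smul, ← map_smul, ← hb, Algebra.algebraMap_eq_smul_one]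
    have h2 : a * g u i = b * g 1 i := by simpa using DFunLike.congr_fun h1 i
    refine (IsSMulRegular.of_ne_zero ha : IsSMulRegular T a) ?_
    simp only
    rw [← smul_mul_assoc, ← hb, ← map_mul, ← h2, map_mul, Algebra.smul_def]
  intro u
  have h1 : (1 : T) = (g 1).sum fun i a ↦ a • i := by
    simpa [Finsupp.linearCombination_apply] using (LinearMap.congr_fun hg 1).symm
  refine ⟨(g 1).sum fun i a ↦ g (u * i) i, ?_⟩
  conv_rhs => rw [← mul_one u, h1, Finsupp.mul_sum]
  rw [Finsupp.sum, map_sum]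
  refine Finset.sum_congr rfl fun i _ ↦ ?_
  rw [← key]
  simp only [Algebra.smul_def]
  ring

theorem Algebra.exists_isPrime_mem_iff_dvd_mul
    {R S : Type*} [CommRing R] [IsNoetherianRing R] [CommRing S] [IsDomain S] [Algebra R S]
    [FaithfulSMul R S] (h : ∀ s : S, ∃ r : R, r ≠ 0 ∧ r • s ∈ (algebraMap R S).range)
    (hsurj : ¬ Function.Surjective (algebraMap R S)) :
    ∃ (p : Ideal R) (s : S) (x y : R), p.IsPrime ∧ x ≠ 0 ∧ (∀ a, a ∈ p ↔ x ∣ a * y) ∧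
      ∀ a, a • s ∈ (algebraMap R S).range → a ∈ p := by
  let N : Submodule R S := LinearMap.range (Algebra.linearMap R S)
  have hN : ∀ s, s ∈ N ↔ s ∈ (algebraMap R S).range := fun s ↦ Iff.rfl
  have : Nontrivial (S ⧸ N) := by
    rw [Submodule.Quotient.nontrivial_iff]
    exact fun h ↦ hsurj (LinearMap.range_eq_top.1 h)
  obtain ⟨p, hp⟩ := associatedPrimes.nonempty R (S ⧸ N)
  rw [AssociatedPrimes.mem_iff, isAssociatedPrime_iff] at hp
  obtain ⟨hp, m, rfl⟩ := hp
  obtain ⟨s, rfl⟩ := N.mkQ_surjective m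
  have hps : ∀ a, a ∈ (⊥ : Submodule R (S ⧸ N)).colon {N.mkQ s} ↔
      a • s ∈ (algebraMap R S).range := by
    intro a
    rw [Submodule.mem_colon_singleton, ← map_smul, Submodule.mem_bot, Submodule.mkQ_apply,
      Submodule.Quotient.mk_eq_zero, hN]
  obtain ⟨x, hx, y, hy⟩ := h s
  refine ⟨_, s, x, y, hp, hx, fun a ↦ ?_, fun a ↦ (hps a).2⟩
  have hinj := FaithfulSMul.algebraMap_injective R S
  rw [hps]
  constructor
  · rintro ⟨b, hb⟩
    refine ⟨b, hinj ?_⟩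
    rw [map_mul, map_mul, hy, hb, Algebra.smul_def, Algebra.smul_def]
    ring
  · rintro ⟨b, hb⟩
    refine ⟨b, ?_⟩
    have hx' : algebraMap R S x ≠ 0 := by simpa
    apply mul_left_cancel₀ hx'
    rw [← map_mul, ← hb, map_mul, hy, Algebra.smul_def, Algebra.smul_def]
    ring

open CategoryTheory in
theorem Algebra.algebraMap_surjective_of_hasProjectiveDimensionLE
    {R S : Type u} [CommRing R] [IsDomain R] [IsNoetherianRing R] [CommRing S] [IsDomain S]
    [Algebra R S] [FaithfulSMul R S] [Module.Finite R S]
    (h : ∀ s : S, ∃ r : R, r ≠ 0 ∧ r • s ∈ (algebraMap R S).range) (n : ℕ)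
    (hn : HasProjectiveDimensionLE (ModuleCat.of R S) n) :
    Function.Surjective (algebraMap R S) := by
  by_contra hsurj
  obtain ⟨p, s, x, y, hp, hx, hxy, hs⟩ := Algebra.exists_isPrime_mem_iff_dvd_mul h hsurj
  have : Module.IsTorsionFree R S := inferInstance
  let A := Localization p.primeCompl
  let T := LocalizedModule p.primeCompl S
  have hmul₁ (a : A) (t t' : T) : a • t * t' = a • (t * t') := by
    induction a using Localization.induction_on
    induction t, t' using LocalizedModule.induction_on₂
    rw [LocalizedModule.mk_smul_mk, LocalizedModule.mk_mul_mk, LocalizedModule.mk_mul_mk,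
      LocalizedModule.mk_smul_mk, smul_mul_assoc, mul_assoc]
  let _ : Algebra A T :=
    { Algebra.ofModule hmul₁ fun a t t' ↦ by rw [mul_comm, hmul₁, mul_comm] with
      toSMul := OreLocalization.instModule.toSMul }
  have hproj : Module.Projective A T :=
    Module.projective_localizedModule_of_hasProjectiveDimensionLE p hx hxy n S hn
  have htf : Module.IsTorsionFree A T := inferInstance
  have halg : ∀ (r : R) (t : p.primeCompl), algebraMap A T (Localization.mk r t) =
      LocalizedModule.mk (algebraMap R S r) t := by
    intro r t
    rw [Algebra.algebraMap_eq_smul_one, Algebra.algebraMap_eq_smul_one, ← mul_one t,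
      ← LocalizedModule.mk_smul_mk, mul_one]
    with_unfolding_all rfl
  have hsurj' : Function.Surjective (algebraMap A T) := by
    refine Algebra.algebraMap_surjective_of_projective_of_birational fun t ↦ ?_
    induction t using LocalizedModule.induction_on with | _ s t
    obtain ⟨r, hr, r', hr'⟩ := h s
    refine ⟨algebraMap R A r, ?_, Localization.mk r' t, ?_⟩
    · rwa [Ne, IsLocalization.to_map_eq_zero_iff A p.primeCompl_le_nonZeroDivisors]
    · rw [halg, hr', algebraMap_smul, LocalizedModule.smul'_mk]
  obtain ⟨a, ha⟩ := hsurj' (LocalizedModule.mk s 1)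
  obtain ⟨r, t, rfl⟩ := IsLocalization.exists_mk'_eq p.primeCompl a
  rw [← Localization.mk_eq_mk', halg, LocalizedModule.mk_eq] at ha
  obtain ⟨c, hc⟩ := ha
  refine (c * t).2 (hs _ ⟨c * r, ?_⟩)
  simpa [Submonoid.smul_def, Algebra.smul_def, mul_assoc] using hc

open CategoryTheory Abelian in
theorem CategoryTheory.ProjectiveResolution.hasProjectiveDimensionLE_of_isZero
    {C : Type*} [Category C] [Abelian C] {X : C} (P : ProjectiveResolution X) (n : ℕ)
    (h : ∀ i, n < i → Limits.IsZero (P.complex.X i)) : HasProjectiveDimensionLE X n := by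
  let := HasExt.standard C
  refine HasProjectiveDimensionLT.mk fun i hi Y e ↦ ?_
  obtain ⟨f, hf, rfl⟩ := P.extMk_surjective e (i + 1) rfl
  obtain rfl : f = 0 := (h i hi).eq_of_src _ _
  exact P.extMk_zero _ _

section Saturation

variable {N : ℕ}

theorem mem_gp_iff_exists_sub {Q : AddSubmonoid (ZN N)} {q : ZN N} :
    q ∈ gp Q ↔ ∃ a ∈ Q, ∃ b ∈ Q, a - b = q := by
  constructor
  · intro hq
    induction hq using AddSubgroup.closure_induction with
    | mem x hx => exact ⟨x, hx, 0, Q.zero_mem, sub_zero x⟩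
    | zero => exact ⟨0, Q.zero_mem, 0, Q.zero_mem, sub_zero 0⟩
    | add x y _ _ hx hy =>
      obtain ⟨a, ha, b, hb, rfl⟩ := hx
      obtain ⟨c, hc, d, hd, rfl⟩ := hy
      exact ⟨a + c, Q.add_mem ha hc, b + d, Q.add_mem hb hd, by abel⟩
    | neg x _ hx =>
      obtain ⟨a, ha, b, hb, rfl⟩ := hx
      exact ⟨b, hb, a, ha, by abel⟩
  · rintro ⟨a, ha, b, hb, rfl⟩
    exact (gp Q).sub_mem (AddSubgroup.subset_closure ha) (AddSubgroup.subset_closure hb)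

theorem exists_mem_add_of_mem_sat {Q : AddSubmonoid (ZN N)} {G : Finset (ZN N)}
    (hG : AddSubmonoid.closure (G : Set (ZN N)) = Q) {q : ZN N} (hq : q ∈ sat Q) :
    ∃ p ∈ Q, ∃ w ∈ sat Q, p + w = q ∧ ∀ j, |w j| ≤ ∑ g ∈ G, |g j| := by
  obtain ⟨hgp, n, hn, hnq⟩ := hq
  obtain ⟨f, -, hf⟩ := AddSubmonoid.mem_closure_finset.1 (hG ▸ hnq)
  have hsum (c : ZN N → ℕ) : ∑ g ∈ G, c g • g ∈ Q :=
    sum_mem fun g hg ↦ Q.nsmul_mem (hG ▸ AddSubmonoid.subset_closure hg) _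
  set p := ∑ g ∈ G, (f g / n) • g with hp
  have hw : n • (q - p) = ∑ g ∈ G, (f g % n) • g := by
    rw [smul_sub, ← hf, sub_eq_iff_eq_add, hp, Finset.smul_sum, ← Finset.sum_add_distrib]
    refine Finset.sum_congr rfl fun g _ ↦ ?_
    rw [smul_smul, ← add_smul, Nat.mod_add_div]
  refine ⟨p, hsum _, q - p, ⟨(gp Q).sub_mem hgp (AddSubgroup.subset_closure (hsum _)), n, hn,
    hw ▸ hsum _⟩, by abel, fun j ↦ ?_⟩
  have hn' : (0 : ℤ) < n := by exact_mod_cast hn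
  refine le_of_mul_le_mul_left ?_ hn'
  have hj : (n : ℤ) * (q - p) j = ∑ g ∈ G, ((f g % n : ℕ) : ℤ) * g j := by
    simpa [Finset.sum_apply] using congrFun hw j
  rw [← abs_of_pos hn', ← abs_mul, hj, abs_of_pos hn', Finset.mul_sum]
  refine (Finset.abs_sum_le_sum_abs _ _).trans (Finset.sum_le_sum fun g _ ↦ ?_)
  rw [abs_mul, Nat.abs_cast]
  gcongr
  exact (Nat.mod_lt _ hn).le

variable (k : Type) [Field k] (Q : AddSubmonoid (ZN N))

theorem algebraMap_sat_single (q : Q) (r : k) :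
    algebraMap (AddMonoidAlgebra k Q) (AddMonoidAlgebra k (sat Q)) (AddMonoidAlgebra.single q r) =
      AddMonoidAlgebra.single (satIncl Q q) r :=
  AddMonoidAlgebra.mapDomain_single

theorem algebraMap_sat_injective :
    Function.Injective (algebraMap (AddMonoidAlgebra k Q) (AddMonoidAlgebra k (sat Q))) :=
  AddMonoidAlgebra.mapDomain_injective (AddSubmonoid.inclusion_injective (le_sat Q))

theorem twoUniqueSums_zn_submonoid : TwoUniqueSums Q :=
  .of_injective_addHom (G := ZN N) Q.subtype.toAddHom Subtype.val_injective inferInstance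

theorem isDomain_addMonoidAlgebra_zn_submonoid : IsDomain (AddMonoidAlgebra k Q) :=
  have := twoUniqueSums_zn_submonoid Q
  have : NoZeroDivisors (AddMonoidAlgebra k Q) := inferInstance
  NoZeroDivisors.to_isDomain _

variable {Q}

theorem isNoetherianRing_addMonoidAlgebra_of_fg (hQ : Q.FG) :
    IsNoetherianRing (AddMonoidAlgebra k Q) :=
  have : AddMonoid.FG Q := (AddMonoid.fg_iff_addSubmonoid_fg Q).2 hQ
  Algebra.FiniteType.isNoetherianRing k _

theorem finite_addMonoidAlgebra_sat (hQ : Q.FG) :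
    Module.Finite (AddMonoidAlgebra k Q) (AddMonoidAlgebra k (sat Q)) := by
  obtain ⟨G, hG⟩ := hQ
  let B : ZN N := fun j ↦ ∑ g ∈ G, |g j|
  have hfin : {w : sat Q | ∀ j, |(w : ZN N) j| ≤ B j}.Finite := by
    refine Set.Finite.of_finite_image (f := Subtype.val) ((Set.finite_Icc (-B) B).subset ?_)
      Subtype.val_injective.injOn
    rintro _ ⟨w, hw, rfl⟩
    exact ⟨fun j ↦ (abs_le.1 (hw j)).1, fun j ↦ (abs_le.1 (hw j)).2⟩
  refine ⟨Submodule.fg_def.2 ⟨_, hfin.image fun w ↦ AddMonoidAlgebra.single w (1 : k), ?_⟩⟩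
  refine eq_top_iff.2 fun f _ ↦ ?_
  induction f using AddMonoidAlgebra.induction_linear with
  | zero => exact zero_mem _
  | add f g hf hg => exact add_mem (hf trivial) (hg trivial)
  | single q r =>
    obtain ⟨p, hp, w, hw, hpw, hwB⟩ := exists_mem_add_of_mem_sat hG q.2
    have h1 : AddMonoidAlgebra.single q r =
        AddMonoidAlgebra.single (⟨p, hp⟩ : Q) r •
          (AddMonoidAlgebra.single ⟨w, hw⟩ 1 : AddMonoidAlgebra k (sat Q)) := by
      rw [Algebra.smul_def, algebraMap_sat_single, AddMonoidAlgebra.single_mul_single, mul_one]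
      exact congrArg (AddMonoidAlgebra.single · r) (Subtype.ext hpw.symm)
    rw [h1]
    exact Submodule.smul_mem _ _ (Submodule.subset_span ⟨⟨w, hw⟩, hwB, rfl⟩)

variable (Q) in
theorem exists_ne_zero_smul_mem_range_algebraMap_sat (f : AddMonoidAlgebra k (sat Q)) :
    ∃ r : AddMonoidAlgebra k Q, r ≠ 0 ∧
      r • f ∈ (algebraMap (AddMonoidAlgebra k Q) (AddMonoidAlgebra k (sat Q))).range := by
  have := isDomain_addMonoidAlgebra_zn_submonoid k Q
  induction f using AddMonoidAlgebra.induction_linear with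
  | zero => exact ⟨1, one_ne_zero, by simp⟩
  | add f g hf hg =>
    obtain ⟨r, hr, a, ha⟩ := hf
    obtain ⟨s, hs, b, hb⟩ := hg
    refine ⟨r * s, mul_ne_zero hr hs, s * a + r * b, ?_⟩
    rw [map_add, map_mul, map_mul, ha, hb]
    simp only [Algebra.smul_def, map_mul]
    ring
  | single q c =>
    obtain ⟨a, ha, b, hb, hab⟩ := mem_gp_iff_exists_sub.1 q.2.1
    refine ⟨AddMonoidAlgebra.single ⟨b, hb⟩ 1, ?_, AddMonoidAlgebra.single ⟨a, ha⟩ c, ?_⟩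
    · simp
    · rw [Algebra.smul_def, algebraMap_sat_single, algebraMap_sat_single,
        AddMonoidAlgebra.single_mul_single, one_mul]
      refine congrArg (AddMonoidAlgebra.single · c) (Subtype.ext ?_)
      change a = b + (q : ZN N)
      rw [← hab]
      abel

theorem eq_sat_of_algebraMap_sat_surjective
    (h : Function.Surjective (algebraMap (AddMonoidAlgebra k Q) (AddMonoidAlgebra k (sat Q)))) :
    Q = sat Q := by
  refine le_antisymm (le_sat Q) fun q hq ↦ ?_
  obtain ⟨f, hf⟩ := h (AddMonoidAlgebra.single ⟨q, hq⟩ 1)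
  have h1 : (⟨q, hq⟩ : sat Q) ∈ Set.range (satIncl Q) := by
    by_contra hnot
    have h2 : (AddMonoidAlgebra.mapDomain (satIncl Q) f).coeff ⟨q, hq⟩ = 0 :=
      Finsupp.mapDomain_of_notMem_range _ _ hnot
    replace hf : AddMonoidAlgebra.mapDomain (satIncl Q) f = AddMonoidAlgebra.single ⟨q, hq⟩ 1 := hf
    rw [hf] at h2
    simp at h2
  obtain ⟨p, hp⟩ := h1
  rw [← show (p : ZN N) = q from congrArg Subtype.val hp]
  exact p.2

theorem algebraMap_sat_surjective_of_eq_sat (h : Q = sat Q) :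
    Function.Surjective (algebraMap (AddMonoidAlgebra k Q) (AddMonoidAlgebra k (sat Q))) := by
  intro f
  induction f using AddMonoidAlgebra.induction_linear with
  | zero => exact ⟨0, map_zero _⟩
  | add f g hf hg =>
    obtain ⟨a, rfl⟩ := hf
    obtain ⟨b, rfl⟩ := hg
    exact ⟨a + b, map_add _ _ _⟩
  | single q c => exact ⟨AddMonoidAlgebra.single ⟨q, h.ge q.2⟩ c, algebraMap_sat_single ..⟩

end Saturation

/-- `Q` is normal iff `k[sat Q]` has finite projective dimension as a
`k[Q]`-module, i.e. iff it admits a projective resolution vanishing in all sufficiently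
large degrees. -/
theorem normal_iff_finite_projective_dimension (k : Type) [Field k] {N : ℕ}
    (Q : AddSubmonoid (ZN N)) (hQ : Q.FG) :
    Q = sat Q ↔
      ∃ (P : CategoryTheory.ProjectiveResolution
          (ModuleCat.of (AddMonoidAlgebra k ↥Q) (AddMonoidAlgebra k ↥(sat Q))))
        (n : ℕ), ∀ i : ℕ, n < i → CategoryTheory.Limits.IsZero (P.complex.X i) := by
  constructor
  · intro h
    have : Module.Projective (AddMonoidAlgebra k Q) (AddMonoidAlgebra k (sat Q)) :=
      .of_equiv (LinearEquiv.ofBijective (Algebra.linearMap _ _)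
        ⟨algebraMap_sat_injective k Q, algebraMap_sat_surjective_of_eq_sat k h⟩)
    have := ModuleCat.projective_of_categoryTheory_projective
      (ModuleCat.of (AddMonoidAlgebra k Q) (AddMonoidAlgebra k (sat Q)))
    exact ⟨.self _, 0, fun i hi ↦ HomologicalComplex.isZero_single_obj_X _ _ _ _ hi.ne'⟩
  · rintro ⟨P, n, hP⟩
    have := isDomain_addMonoidAlgebra_zn_submonoid k Q
    have := isDomain_addMonoidAlgebra_zn_submonoid k (sat Q)
    have := isNoetherianRing_addMonoidAlgebra_of_fg k hQ
    have := finite_addMonoidAlgebra_sat k hQ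
    have := (faithfulSMul_iff_algebraMap_injective _ _).2 (algebraMap_sat_injective k Q)
    exact eq_sat_of_algebraMap_sat_surjective k
      (Algebra.algebraMap_surjective_of_hasProjectiveDimensionLE
        (exists_ne_zero_smul_mem_range_algebraMap_sat k Q) n
        (P.hasProjectiveDimensionLE_of_isZero n hP))
end

section
/- Let Q be a seminormal affine monoid and let q ∈ gp(Q). Then there exists a positive integer m such that for every j ∈ ℕ and every face F of Q one has q ∈ Q_F if and only if (1 + mj)•q ∈ Q_F. -/
open scoped Pointwise

/-- A face of `Q` is generated by the generators of `Q` it contains. -/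
theorem IsFace.closure_inter_eq {N : ℕ} {Q F : AddSubmonoid (ZN N)} (hF : IsFace Q F)
    {S : Set (ZN N)} (hS : AddSubmonoid.closure S = Q) :
    AddSubmonoid.closure (S ∩ F) = F := by
  apply le_antisymm (AddSubmonoid.closure_le.mpr Set.inter_subset_right)
  intro x hx
  have hxS : x ∈ AddSubmonoid.closure S := hS ▸ hF.1 hx
  induction hxS using AddSubmonoid.closure_induction with
  | mem y hy => exact AddSubmonoid.subset_closure ⟨hy, hx⟩
  | zero => exact zero_mem _
  | add y z hy hz ihy ihz =>
    obtain ⟨hyF, hzF⟩ := (hF.2 y z (hS ▸ hy) (hS ▸ hz)).mp hx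
    exact add_mem (ihy hyF) (ihz hzF)

/-- A finitely generated monoid has finitely many faces. -/
theorem finite_setOf_isFace {N : ℕ} {Q : AddSubmonoid (ZN N)} (hQ : Q.FG) :
    {F | IsFace Q F}.Finite := by
  obtain ⟨S, hS⟩ := hQ
  refine (S.finite_toSet.finite_subsets.image AddSubmonoid.closure).subset ?_
  exact fun F hF => ⟨S ∩ F, Set.inter_subset_left, hF.closure_inter_eq hS⟩

/-- Localizations of a seminormal monoid satisfy the seminormality condition on `gp(Q)`. -/
theorem Seminormal.mem_loc {N : ℕ} {Q F : AddSubmonoid (ZN N)} (hsn : Seminormal Q)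
    (hF : F ≤ Q) {q : ZN N} (hq : q ∈ gp Q) (h2 : 2 • q ∈ loc Q F) (h3 : 3 • q ∈ loc Q F) :
    q ∈ loc Q F := by
  obtain ⟨a, ha, f, hf, h2⟩ := h2
  obtain ⟨b, hb, g, hg, h3⟩ := h3
  have hfg : f + g ∈ F := add_mem hf hg
  refine ⟨q + (f + g), hsn _ (add_mem hq (AddSubgroup.subset_closure (hF hfg))) ?_ ?_,
    f + g, hfg, by abel⟩
  · have : 2 • (q + (f + g)) = a + (f + 2 • g) := by rw [smul_add, h2]; abel
    rw [this]
    exact add_mem ha (hF (add_mem hf (nsmul_mem hg 2)))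
  · have : 3 • (q + (f + g)) = b + (3 • f + 2 • g) := by rw [smul_add, h3]; abel
    rw [this]
    exact add_mem hb (hF (add_mem (nsmul_mem hf 3) (nsmul_mem hg 2)))

/-- If all sufficiently large multiples of `q` lie in a localization of a seminormal monoid,
then so does `q`. -/
theorem Seminormal.mem_loc_of_forall_ge {N : ℕ} {Q F : AddSubmonoid (ZN N)}
    (hsn : Seminormal Q) (hF : F ≤ Q) {q : ZN N} (hq : q ∈ gp Q) (n : ℕ)
    (hn : ∀ k ≥ n, k • q ∈ loc Q F) : q ∈ loc Q F := by
  induction n with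
  | zero => simpa using hn 1 (Nat.zero_le 1)
  | succ n ih =>
    rcases Nat.eq_zero_or_pos n with rfl | hpos
    · simpa using hn 1 le_rfl
    refine ih fun k hk => ?_
    refine hsn.mem_loc hF (nsmul_mem hq k) ?_ ?_
    · rw [smul_smul]
      exact hn _ (by omega)
    · rw [smul_smul]
      exact hn _ (by omega)

theorem Seminormal.exists_pos_forall_dvd {N : ℕ} {Q F : AddSubmonoid (ZN N)}
    (hsn : Seminormal Q) (hF : F ≤ Q) {q : ZN N} (hq : q ∈ gp Q) :
    ∃ d : ℕ, 0 < d ∧ ∀ m, d ∣ m → ((1 + m) • q ∈ loc Q F → q ∈ loc Q F) := by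
  set T : AddSubmonoid ℕ := (loc Q F).comap (multiplesHom (ZN N) q)
  have hT : ∀ k : ℕ, k ∈ T ↔ k • q ∈ loc Q F := fun k => by simp [T]
  rcases Nat.eq_zero_or_pos (Nat.setGcd (T : Set ℕ)) with h0 | hpos
  · refine ⟨1, one_pos, fun m _ hm => ?_⟩
    have := Nat.setGcd_dvd_of_mem (SetLike.mem_coe.mpr ((hT _).mpr hm))
    rw [h0, zero_dvd_iff] at this
    omega
  · refine ⟨_, hpos, fun m hdm hm => ?_⟩
    have hd := Nat.setGcd_dvd_of_mem (SetLike.mem_coe.mpr ((hT _).mpr hm))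
    have h1 := (Nat.dvd_add_left hdm).mp hd
    obtain ⟨n, hn⟩ := Nat.exists_mem_closure_of_ge (T : Set ℕ)
    refine hsn.mem_loc_of_forall_ge hF hq n fun k hk => (hT k).mp ?_
    have := hn k hk (h1.trans (one_dvd k))
    rwa [AddSubmonoid.closure_eq] at this

/-- In a seminormal affine monoid, for every `q ∈ gp(Q)` there is a
positive integer `m` such that membership of `q` and of `(1 + m·j) • q` in any
localization `Q_F` agree, for all `j ∈ ℕ`. -/
theorem seminormal_ray_constant {N : ℕ} (Q : AddSubmonoid (ZN N)) (hQ : Q.FG)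
    (hsn : Seminormal Q) (q : ZN N) (hq : q ∈ gp Q) :
    ∃ m : ℕ, 0 < m ∧ ∀ (j : ℕ) (F : AddSubmonoid (ZN N)), IsFace Q F →
      (q ∈ loc Q F ↔ (1 + m * j) • q ∈ loc Q F) := by
  choose! d hd_pos hd using fun F (hF : IsFace Q F) => hsn.exists_pos_forall_dvd hF.1 hq
  have hfin := finite_setOf_isFace hQ
  refine ⟨∏ F ∈ hfin.toFinset, d F,
    Finset.prod_pos fun F hF => hd_pos F (hfin.mem_toFinset.mp hF), fun j F hF =>
    ⟨fun h => nsmul_mem h _, hd F hF _ (Dvd.dvd.mul_right ?_ j)⟩⟩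
  exact Finset.dvd_prod_of_mem d (hfin.mem_toFinset.mpr hF)
end

section
/- Let Q be an affine monoid and let q ∈ gp(Q) be such that −q ∈ sat(Q). Then the set of faces F of Q with q ∈ (sat(Q))_F is nonempty and has a unique minimal element with respect to inclusion; that is, there is a face F with q ∈ (sat(Q))_F such that F ⊆ G for every face G with q ∈ (sat(Q))_G. -/
open scoped Pointwise

/-- The smallest face of `Q` containing `p`: all `a ∈ Q` dividing a multiple of `p` in `Q`. -/
def faceGenerated {N : ℕ} (Q : AddSubmonoid (ZN N)) (p : ZN N) : AddSubmonoid (ZN N) where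
  carrier := {a | a ∈ Q ∧ ∃ b ∈ Q, ∃ k : ℕ, a + b = k • p}
  zero_mem' := ⟨Q.zero_mem, 0, Q.zero_mem, 0, by simp⟩
  add_mem' := by
    rintro a a' ⟨ha, b, hb, k, hk⟩ ⟨ha', b', hb', k', hk'⟩
    exact ⟨Q.add_mem ha ha', b + b', Q.add_mem hb hb', k + k', by
      rw [add_add_add_comm, hk, hk', add_smul]⟩

theorem isFace_faceGenerated {N : ℕ} (Q : AddSubmonoid (ZN N)) (p : ZN N) :
    IsFace Q (faceGenerated Q p) := by
  refine ⟨fun a ha => ha.1, fun a b ha hb => ⟨?_, fun h => add_mem h.1 h.2⟩⟩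
  rintro ⟨-, c, hc, k, hk⟩
  exact ⟨⟨ha, b + c, Q.add_mem hb hc, k, by rw [← hk, add_assoc]⟩,
    ⟨hb, a + c, Q.add_mem ha hc, k, by rw [← hk]; abel⟩⟩

theorem mem_faceGenerated {N : ℕ} {Q : AddSubmonoid (ZN N)} {p : ZN N} (hp : p ∈ Q) :
    p ∈ faceGenerated Q p :=
  ⟨hp, 0, Q.zero_mem, 1, by simp⟩

theorem faceGenerated_le {N : ℕ} {Q G : AddSubmonoid (ZN N)} {p : ZN N} (hG : IsFace Q G)
    (hp : p ∈ G) : faceGenerated Q p ≤ G := by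
  rintro a ⟨ha, b, hb, k, hk⟩
  exact ((hG.2 a b ha hb).1 (hk ▸ G.nsmul_mem hp k)).1

theorem IsFace.mem_of_nsmul_mem {N : ℕ} {Q G : AddSubmonoid (ZN N)} (hG : IsFace Q G)
    {p : ZN N} (hp : p ∈ Q) {m : ℕ} (hm : 1 ≤ m) (h : m • p ∈ G) : p ∈ G := by
  obtain ⟨k, rfl⟩ := Nat.exists_eq_add_of_le' hm
  rw [succ_nsmul] at h
  exact ((hG.2 _ _ (Q.nsmul_mem hp k) hp).1 h).2

/-- If `-q ∈ sat(Q)`, then the set of faces `F` of `Q` with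
`q ∈ (sat Q)_F` is nonempty and has a unique minimal element. -/
theorem exists_unique_minimal_face {N : ℕ} (Q : AddSubmonoid (ZN N)) (hQ : Q.FG)
    (q : ZN N) (hq : q ∈ gp Q) (hnq : -q ∈ sat Q) :
    ∃ F : AddSubmonoid (ZN N), IsFace Q F ∧ q ∈ loc (sat Q) F ∧
      ∀ G : AddSubmonoid (ZN N), IsFace Q G → q ∈ loc (sat Q) G → F ≤ G := by
  obtain ⟨-, n, hn, hp⟩ := id hnq
  refine ⟨faceGenerated Q (n • -q), isFace_faceGenerated Q _, ?_, ?_⟩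
  · obtain ⟨k, rfl⟩ := Nat.exists_eq_add_of_le' hn
    exact ⟨k • -q, (sat Q).nsmul_mem hnq k, _, mem_faceGenerated hp, by
      rw [succ_nsmul]; abel⟩
  · rintro G hG ⟨s, ⟨-, m, hm, hs⟩, g, hg, hqs⟩
    refine faceGenerated_le hG (hG.mem_of_nsmul_mem hp hm ?_)
    have key : m • (n • -q) + n • (m • s) = (m * n) • g := by
      rw [hqs, smul_smul, smul_smul, mul_comm n m, ← smul_add]
      congr 1
      abel
    exact ((hG.2 _ _ (Q.nsmul_mem hp m) (Q.nsmul_mem hs n)).1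
      (key ▸ G.nsmul_mem hg (m * n))).1
end
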